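/- Let (a_g)_{g≥1} and (d_g)_{g≥1} be sequences of positive real numbers such that (a_g) satisfies the volume recursion and (d_g) satisfies the Siegel–Veech recursion relative to (a_g). Then 2·d_g = (2g−2)!·b_{g−1} + O((2g−2)!·b_{g−1}/g) as g → ∞; that is, there exist C > 0 and g_0 such that for all g ≥ g_0, |2·d_g − (2g−2)!·b_{g−1}| ≤ C·(2g−2)!·b_{g−1}/g. -/

import Mathlib

open Finset Real

noncomputable section

/-- `b_g = ((2^(2g-1) - 1)/2^(2g-1)) · |B_{2g}|/(2g)!` for `g ≥ 1`, and `b_0 = 1`. -/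
def bSeq (g : ℕ) : ℚ :=
  if g = 0 then 1
  else ((2 ^ (2 * g - 1) - 1) / 2 ^ (2 * g - 1)) * |bernoulli (2 * g)| /
    (Nat.factorial (2 * g) : ℚ)

/-- The sequence `b_g` viewed as real numbers. -/
def bR (g : ℕ) : ℝ := (bSeq g : ℝ)

/-- The sum over ordered `k`-tuples of positive integers with sum `g` of
`∏_j (2 d_j - 1) a_{d_j}`. -/
def tupleSum (a : ℕ → ℝ) (k g : ℕ) : ℝ :=
  ∑ d ∈ (Finset.Nat.antidiagonalTuple k g).filter (fun d => ∀ j, 0 < d j),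
    ∏ j, ((2 * (d j : ℝ) - 1) * a (d j))

/-- The volume recursion for a sequence `(a_g)_{g ≥ 1}`:
`b_g = Σ_{k=1}^{g} (1/(k!·(2g−k)!)) · Σ_{d_1+⋯+d_k=g} ∏ (2d_j−1)·a_{d_j}`. -/
def VolumeRecursion (a : ℕ → ℝ) : Prop :=
  ∀ g : ℕ, 1 ≤ g →
    bR g = ∑ k ∈ Finset.Icc 1 g,
      (1 / ((Nat.factorial k * Nat.factorial (2 * g - k) : ℕ) : ℝ)) * tupleSum a k g

/-- The Siegel–Veech recursion for `(d_g)_{g ≥ 1}` relative to `(a_g)_{g ≥ 1}`: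
`b_{g−1}/2 = Σ_{g'=1}^{g} Σ_{k=0}^{g−g'} ((2g'−1)·d_{g'}/(k!·(2g−1−k)!)) ·
Σ_{g_1+⋯+g_k=g−g'} ∏ (2g_i−1)·a_{g_i}`. -/
def SVRecursion (a d : ℕ → ℝ) : Prop :=
  ∀ g : ℕ, 1 ≤ g →
    bR (g - 1) / 2 =
      ∑ g' ∈ Finset.Icc 1 g, ∑ k ∈ Finset.range (g - g' + 1),
        ((2 * (g' : ℝ) - 1) * d g' /
          ((Nat.factorial k * Nat.factorial (2 * g - 1 - k) : ℕ) : ℝ)) *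
          tupleSum a k (g - g')

/-- Bounds on `b_g` from the values of the zeta function at even integers. -/
lemma bR_bounds (g : ℕ) :
    (1 / (2 * π) ^ 2) ^ g ≤ bR g ∧ bR g ≤ 4 * (1 / (2 * π) ^ 2) ^ g := by
  rcases Nat.eq_zero_or_pos g with rfl | hg
  · norm_num [bR, bSeq]
  have hz := hasSum_zeta_nat hg.ne'
  set z := (-1 : ℝ) ^ (g + 1) * (2 : ℝ) ^ (2 * g - 1) * π ^ (2 * g) *
    bernoulli (2 * g) / (Nat.factorial (2 * g)) with hzdef
  have hz1 : 1 ≤ z := by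
    simpa using le_hasSum hz 1 fun j _ => by positivity
  have hz2 : z ≤ 2 := by
    have h : z ≤ π ^ 2 / 6 := by
      refine hasSum_le (fun n => ?_) hz hasSum_zeta_two
      rcases Nat.eq_zero_or_pos n with rfl | hn
      · simp [hg.ne']
      · have hn' : (1 : ℝ) ≤ n := by exact_mod_cast hn
        exact one_div_le_one_div_of_le (by positivity) (pow_le_pow_right₀ hn' (by omega))
    nlinarith [pi_lt_d2, pi_pos]
  have hfac : (0 : ℝ) < Nat.factorial (2 * g) := by positivity
  have habs : z = (2 : ℝ) ^ (2 * g - 1) * π ^ (2 * g) * |(bernoulli (2 * g) : ℝ)| /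
      Nat.factorial (2 * g) := by
    rw [← abs_of_pos (lt_of_lt_of_le one_pos hz1), hzdef]
    simp only [abs_div, abs_mul, abs_pow, abs_neg, abs_one, one_pow, one_mul, Nat.abs_cast,
      abs_of_pos pi_pos, Nat.abs_ofNat]
  have hpow : (2 : ℝ) ^ (2 * g) = 2 * 2 ^ (2 * g - 1) := by
    rw [← pow_succ']
    congr 1
    omega
  have hb : bR g = (1 - 1 / 2 ^ (2 * g - 1)) * (2 * z) * (1 / (2 * π) ^ 2) ^ g := by
    rw [habs, bR, bSeq, if_neg hg.ne', one_div_pow, ← pow_mul, mul_pow, hpow]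
    push_cast
    have := pi_pos
    field_simp
  have hr : 0 < (1 / (2 * π) ^ 2) ^ g := by positivity
  have hhalf : (1 : ℝ) / 2 ^ (2 * g - 1) ≤ 1 / 2 := by
    have h : (2 : ℝ) ^ 1 ≤ 2 ^ (2 * g - 1) := pow_le_pow_right₀ (by norm_num) (by omega)
    rw [pow_one] at h
    gcongr
  have hpos : (0 : ℝ) < 1 / 2 ^ (2 * g - 1) := by positivity
  rw [hb]
  constructor
  · exact le_mul_of_one_le_left hr.le (by nlinarith)
  · exact mul_le_mul_of_nonneg_right (by nlinarith) hr.le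

lemma tupleSum_zero_succ (a : ℕ → ℝ) (n : ℕ) : tupleSum a 0 (n + 1) = 0 := by
  simp [tupleSum]

lemma tupleSum_zero_zero (a : ℕ → ℝ) : tupleSum a 0 0 = 1 := by
  simp [tupleSum]

lemma tupleSum_succ (a : ℕ → ℝ) (k n : ℕ) :
    tupleSum a (k + 1) n =
      ∑ i ∈ range n, (2 * ((i + 1 : ℕ) : ℝ) - 1) * a (i + 1) * tupleSum a k (n - (i + 1)) := by
  simp only [tupleSum, mul_sum]
  rw [sum_sigma']
  refine sum_nbij' (fun d => ⟨d 0 - 1, Fin.tail d⟩) (fun p => Fin.cons (p.1 + 1) p.2) ?_ ?_ ?_ ?_ ?_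
  · intro d hd
    simp only [mem_filter, Finset.Nat.mem_antidiagonalTuple, mem_sigma, mem_range,
      Fin.sum_univ_succ, Fin.tail] at hd ⊢
    have := hd.2 0
    exact ⟨by omega, by omega, fun j => hd.2 _⟩
  · rintro ⟨i, e⟩ he
    simp only [mem_filter, Finset.Nat.mem_antidiagonalTuple, mem_sigma, mem_range,
      Fin.sum_univ_succ, Fin.cons_zero, Fin.cons_succ, Fin.forall_fin_succ] at he ⊢
    exact ⟨by omega, by omega, he.2.2⟩
  · intro d hd
    have := (mem_filter.1 hd).2 0
    simp [Nat.sub_add_cancel this]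
  · rintro ⟨i, e⟩ _
    simp
  · intro d hd
    have := (mem_filter.1 hd).2 0
    simp [Fin.prod_univ_succ, Nat.sub_add_cancel this, Fin.tail]

lemma tupleSum_one_succ (a : ℕ → ℝ) (n : ℕ) :
    tupleSum a 1 (n + 1) = (2 * ((n + 1 : ℕ) : ℝ) - 1) * a (n + 1) := by
  rw [tupleSum_succ, sum_range_succ, Nat.sub_self, tupleSum_zero_zero, mul_one,
    sum_eq_zero, zero_add]
  intro i hi
  rw [show n + 1 - (i + 1) = n - i - 1 + 1 by have := mem_range.1 hi; omega,
    tupleSum_zero_succ, mul_zero]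

lemma tupleSum_eq_zero_of_lt (a : ℕ → ℝ) {k n : ℕ} (h : n < k) : tupleSum a k n = 0 := by
  induction k generalizing n with
  | zero => omega
  | succ k ih =>
    rw [tupleSum_succ]
    refine sum_eq_zero fun i hi => ?_
    rw [ih (by have := mem_range.1 hi; omega), mul_zero]

lemma tupleSum_nonneg {a : ℕ → ℝ} (ha : ∀ g : ℕ, 1 ≤ g → 0 < a g) (k n : ℕ) :
    0 ≤ tupleSum a k n := by
  refine sum_nonneg fun d hd => prod_nonneg fun j _ => ?_
  have h : 1 ≤ d j := (mem_filter.1 hd).2 j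
  have h' : (1 : ℝ) ≤ d j := by exact_mod_cast h
  have := ha _ h
  exact mul_nonneg (by linarith) this.le

lemma factorial_mul_factorial_le (p q : ℕ) :
    Nat.factorial (p + 3) * Nat.factorial (q + 3) ≤ 6 * Nat.factorial (p + q + 3) := by
  induction q with
  | zero => simp [Nat.factorial]; omega
  | succ q ih =>
    rw [show q + 1 + 3 = q + 3 + 1 by omega, show p + (q + 1) + 3 = p + q + 3 + 1 by omega,
      Nat.factorial_succ (q + 3), Nat.factorial_succ (p + q + 3)]
    calc _ = (q + 3 + 1) * (Nat.factorial (p + 3) * Nat.factorial (q + 3)) := by ring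
      _ ≤ (p + q + 3 + 1) * (6 * Nat.factorial (p + q + 3)) := by gcongr; omega
      _ = _ := by ring

lemma sum_odd_factorial_mul_le (n : ℕ) :
    ∑ i ∈ range (n + 1), Nat.factorial (2 * i + 1) * Nat.factorial (2 * (n - i) + 1) ≤
      8 * Nat.factorial (2 * n + 1) := by
  rcases n with _ | m
  · simp
  rw [sum_range_succ, sum_range_succ']
  have hmid : ∑ i ∈ range m, Nat.factorial (2 * (i + 1) + 1) *
      Nat.factorial (2 * (m + 1 - (i + 1)) + 1) ≤ m * (6 * Nat.factorial (2 * m + 1)) := by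
    refine (sum_le_card_nsmul _ _ (6 * Nat.factorial (2 * m + 1)) fun i hi => ?_).trans
      (by simp)
    have hi := mem_range.1 hi
    have h := factorial_mul_factorial_le (2 * i) (2 * (m - i - 1))
    rwa [show 2 * i + 3 = 2 * (i + 1) + 1 by ring,
      show 2 * (m - i - 1) + 3 = 2 * (m + 1 - (i + 1)) + 1 by omega,
      show 2 * i + 2 * (m - i - 1) + 3 = 2 * m + 1 by omega] at h
  have htop : m * Nat.factorial (2 * m + 1) ≤ Nat.factorial (2 * (m + 1) + 1) := by
    rw [show 2 * (m + 1) + 1 = 2 * m + 1 + 1 + 1 by ring, Nat.factorial_succ (2 * m + 1 + 1),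
      Nat.factorial_succ (2 * m + 1), ← mul_assoc]
    gcongr
    nlinarith
  simp only [mul_zero, zero_add, Nat.factorial_one, one_mul, Nat.sub_zero, Nat.sub_self, mul_one]
  linarith

/-- A sequence with `(2 i - 1) a_i ≤ c r^i (2 i - 1)!` has tuple sums dominated by the tuple
`(n, 1, …, 1)`. -/
lemma tupleSum_le {a : ℕ → ℝ} {c r : ℝ} (ha : ∀ g : ℕ, 1 ≤ g → 0 < a g) (hc : 0 ≤ c) (hr : 0 ≤ r)
    (h : ∀ i : ℕ, (2 * ((i + 1 : ℕ) : ℝ) - 1) * a (i + 1) ≤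
      c * r ^ (i + 1) * Nat.factorial (2 * i + 1)) (k s : ℕ) :
    tupleSum a (k + 1) (k + 1 + s) ≤
      (8 * c) ^ (k + 1) * r ^ (k + 1 + s) * Nat.factorial (2 * s + 1) := by
  induction k generalizing s with
  | zero =>
    rw [zero_add, add_comm 1 s, tupleSum_one_succ, pow_one]
    refine (h s).trans ?_
    gcongr
    linarith
  | succ k ih =>
    have hsub : ∀ i ∈ range (k + 1 + 1 + s), i ∉ range (s + 1) →
        (2 * ((i + 1 : ℕ) : ℝ) - 1) * a (i + 1) *
          tupleSum a (k + 1) (k + 1 + 1 + s - (i + 1)) = 0 := by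
      intro i _ hi
      rw [mem_range] at hi
      rw [tupleSum_eq_zero_of_lt a (by omega), mul_zero]
    rw [tupleSum_succ, ← sum_subset (range_mono (by omega)) hsub]
    have hsum : (∑ i ∈ range (s + 1), (Nat.factorial (2 * i + 1) : ℝ) *
        Nat.factorial (2 * (s - i) + 1)) ≤ 8 * Nat.factorial (2 * s + 1) := by
      exact_mod_cast sum_odd_factorial_mul_le s
    calc _ ≤ ∑ i ∈ range (s + 1), c * (8 * c) ^ (k + 1) * r ^ (k + 1 + 1 + s) *
          ((Nat.factorial (2 * i + 1) : ℝ) * Nat.factorial (2 * (s - i) + 1)) := by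
          refine sum_le_sum fun i hi => ?_
          have hi := mem_range.1 hi
          have h1 := ih (s - i)
          rw [show k + 1 + (s - i) = k + 1 + 1 + s - (i + 1) by omega] at h1
          refine (mul_le_mul (h i) h1 (tupleSum_nonneg ha _ _) (by positivity)).trans_eq ?_
          rw [← pow_sub_mul_pow r (show i + 1 ≤ k + 1 + 1 + s by omega)]
          ring
      _ ≤ c * (8 * c) ^ (k + 1) * r ^ (k + 1 + 1 + s) * (8 * Nat.factorial (2 * s + 1)) := by
          rw [← mul_sum]
          gcongr
      _ = _ := by ring

lemma VolumeRecursion.le {a : ℕ → ℝ} (hapos : ∀ g : ℕ, 1 ≤ g → 0 < a g) (ha : VolumeRecursion a)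
    (i : ℕ) :
    (2 * ((i + 1 : ℕ) : ℝ) - 1) * a (i + 1) ≤ bR (i + 1) * Nat.factorial (2 * i + 1) := by
  have h := ha (i + 1) (by omega)
  have h1 := single_le_sum (f := fun k => (1 / ((Nat.factorial k *
    Nat.factorial (2 * (i + 1) - k) : ℕ) : ℝ)) * tupleSum a k (i + 1))
    (fun k _ => mul_nonneg (by positivity) (tupleSum_nonneg hapos _ _))
    (mem_Icc.2 ⟨le_rfl, by omega⟩ : 1 ∈ Icc 1 (i + 1))
  rw [← h] at h1
  simp only [tupleSum_one_succ, Nat.factorial_one, one_mul,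
    show 2 * (i + 1) - 1 = 2 * i + 1 by omega] at h1
  rwa [one_div_mul_eq_div, div_le_iff₀ (by positivity)] at h1

/-- The Siegel–Veech recursion with its leading term isolated and the other terms sorted by the
length of the tuples. -/
lemma SVRecursion.eq_add {a d : ℕ → ℝ} (hd : SVRecursion a d) (G : ℕ) :
    bR G / 2 = (2 * ((G + 1 : ℕ) : ℝ) - 1) * d (G + 1) / Nat.factorial (2 * G + 1) +
      ∑ k ∈ range G, ∑ i ∈ range (G - k),
        (2 * ((i + 1 : ℕ) : ℝ) - 1) * d (i + 1) * tupleSum a (k + 1) (G - i) /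
          (Nat.factorial (k + 1) * Nat.factorial (2 * G - k)) := by
  have h := hd (G + 1) (by omega)
  rw [Nat.add_sub_cancel] at h
  rw [h, ← Ico_add_one_right_eq_Icc, sum_Ico_eq_sum_range, Nat.add_sub_cancel, sum_range_succ,
    add_comm]
  congr 1
  · rw [add_comm 1 G, Nat.sub_self, zero_add, sum_range_one, tupleSum_zero_zero,
      show 2 * (G + 1) - 1 - 0 = 2 * G + 1 by omega]
    simp
  · rw [sum_comm' (s := range G) (t := fun k => range (G - k)) (t' := range G) (s' := fun i => range (G - i))
      (by simp only [mem_range]; omega)]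
    refine sum_congr rfl fun i hi => ?_
    have hi := mem_range.1 hi
    rw [show G + 1 - (1 + i) + 1 = G - i + 1 by omega, sum_range_succ',
      show G + 1 - (1 + i) = G - i - 1 + 1 by omega, tupleSum_zero_succ, mul_zero, add_zero,
      Nat.sub_add_cancel (by omega)]
    refine sum_congr rfl fun k _ => ?_
    rw [show 2 * (G + 1) - 1 - (k + 1) = 2 * G - k by omega, add_comm 1 i, div_mul_eq_mul_div,
      Nat.cast_mul]

lemma factorial_two_mul_sub_ge {G k : ℕ} (hk : k < G) :
    (G + 1) * Nat.factorial (2 * (G - k - 1) + 1) ≤ Nat.factorial (2 * G - k) := by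
  rw [show 2 * G - k = 2 * G - k - 1 + 1 by omega, Nat.factorial_succ (2 * G - k - 1)]
  exact Nat.mul_le_mul (by omega) (Nat.factorial_le (by omega))

theorem stmt13 (a d : ℕ → ℝ)
    (hapos : ∀ g : ℕ, 1 ≤ g → 0 < a g) (hdpos : ∀ g : ℕ, 1 ≤ g → 0 < d g)
    (ha : VolumeRecursion a) (hd : SVRecursion a d) :
    ∃ C > (0 : ℝ), ∃ g0 : ℕ, ∀ g : ℕ, g0 ≤ g →
      |2 * d g - (Nat.factorial (2 * g - 2) : ℝ) * bR (g - 1)| ≤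
        C * ((Nat.factorial (2 * g - 2) : ℝ) * bR (g - 1)) / (g : ℝ) := by
  set r : ℝ := 1 / (2 * π) ^ 2 with hr
  have hr0 : 0 < r := by positivity
  have hα : ∀ i : ℕ, (2 * ((i + 1 : ℕ) : ℝ) - 1) * a (i + 1) ≤
      4 * r ^ (i + 1) * Nat.factorial (2 * i + 1) := fun i =>
    (ha.le hapos i).trans (by gcongr; exact (bR_bounds _).2)
  have hT := tupleSum_le hapos (by norm_num) hr0.le hα
  have hδpos : ∀ i : ℕ, 0 ≤ (2 * ((i + 1 : ℕ) : ℝ) - 1) * d (i + 1) := fun i => by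
    have := hdpos (i + 1) (by omega)
    push_cast
    exact mul_nonneg (by linarith [(Nat.cast_nonneg i : (0 : ℝ) ≤ i)]) this.le
  have hterm : ∀ G k i : ℕ, 0 ≤ (2 * ((i + 1 : ℕ) : ℝ) - 1) * d (i + 1) *
      tupleSum a (k + 1) (G - i) / (Nat.factorial (k + 1) * Nat.factorial (2 * G - k)) :=
    fun G k i => div_nonneg (mul_nonneg (hδpos i) (tupleSum_nonneg hapos _ _)) (by positivity)
  have hδ : ∀ i : ℕ, (2 * ((i + 1 : ℕ) : ℝ) - 1) * d (i + 1) ≤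
      2 * r ^ i * Nat.factorial (2 * i + 1) := fun i => by
    rw [← div_le_iff₀ (by positivity)]
    have h1 := hd.eq_add i
    have h2 := sum_nonneg fun k (_ : k ∈ range i) => sum_nonneg fun j (_ : j ∈ range (i - k)) =>
      hterm i k j
    linarith [(bR_bounds i).2]
  refine ⟨32 * exp 32, by positivity, 1, fun g hg => ?_⟩
  obtain ⟨G, rfl⟩ : ∃ G, g = G + 1 := ⟨g - 1, by omega⟩
  rw [Nat.add_sub_cancel, show 2 * (G + 1) - 2 = 2 * G by omega]
  have heq := hd.eq_add G
  set E := ∑ k ∈ range G, ∑ i ∈ range (G - k),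
        (2 * ((i + 1 : ℕ) : ℝ) - 1) * d (i + 1) * tupleSum a (k + 1) (G - i) /
          (Nat.factorial (k + 1) * Nat.factorial (2 * G - k)) with hE
  have hE0 : 0 ≤ E := sum_nonneg fun k _ => sum_nonneg fun j _ => hterm G k j
  have hEle : E ≤ 16 * exp 32 * bR G / ((G + 1 : ℕ) : ℝ) := by
    have hinner : ∀ k ∈ range G, ∑ i ∈ range (G - k),
        (2 * ((i + 1 : ℕ) : ℝ) - 1) * d (i + 1) * tupleSum a (k + 1) (G - i) /
          (Nat.factorial (k + 1) * Nat.factorial (2 * G - k)) ≤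
        16 * r ^ G / ((G + 1 : ℕ) : ℝ) * (32 ^ (k + 1) / Nat.factorial (k + 1)) := by
      intro k hk
      have hk := mem_range.1 hk
      obtain ⟨n, rfl⟩ : ∃ n, G = k + 1 + n := ⟨G - k - 1, by omega⟩
      rw [← sum_div, div_le_iff₀ (by positivity)]
      have hfac : ((k + 1 + n + 1 : ℕ) : ℝ) * Nat.factorial (2 * n + 1) ≤
          Nat.factorial (2 * (k + 1 + n) - k) := by
        have h := factorial_two_mul_sub_ge hk
        rw [show k + 1 + n - k - 1 = n by omega] at h
        exact_mod_cast h
      have hsum : (∑ i ∈ range (n + 1), (Nat.factorial (2 * i + 1) : ℝ) *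
          Nat.factorial (2 * (n - i) + 1)) ≤ 8 * Nat.factorial (2 * n + 1) := by
        exact_mod_cast sum_odd_factorial_mul_le n
      rw [show k + 1 + n - k = n + 1 by omega]
      calc _ ≤ ∑ i ∈ range (n + 1), 2 * 32 ^ (k + 1) * r ^ (k + 1 + n) *
            ((Nat.factorial (2 * i + 1) : ℝ) * Nat.factorial (2 * (n - i) + 1)) := by
            refine sum_le_sum fun i hi => ?_
            have hi := mem_range.1 hi
            have h1 := hT k (n - i)
            rw [show k + 1 + (n - i) = k + 1 + n - i by omega] at h1
            refine (mul_le_mul (hδ i) h1 (tupleSum_nonneg hapos _ _) (by positivity)).trans_eq ?_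
            rw [← pow_sub_mul_pow r (show i ≤ k + 1 + n by omega)]
            norm_num
            ring
        _ ≤ 2 * 32 ^ (k + 1) * r ^ (k + 1 + n) * (8 * Nat.factorial (2 * n + 1)) := by
            rw [← mul_sum]
            gcongr
        _ = 16 * r ^ (k + 1 + n) / ((k + 1 + n + 1 : ℕ) : ℝ) * 32 ^ (k + 1) *
            (((k + 1 + n + 1 : ℕ) : ℝ) * Nat.factorial (2 * n + 1)) := by
            field_simp
            ring
        _ ≤ 16 * r ^ (k + 1 + n) / ((k + 1 + n + 1 : ℕ) : ℝ) * 32 ^ (k + 1) *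
            Nat.factorial (2 * (k + 1 + n) - k) := by gcongr
        _ = _ := by
            field_simp
    have hexp : ∑ k ∈ range G, (32 : ℝ) ^ (k + 1) / Nat.factorial (k + 1) ≤ exp 32 := by
      have h := sum_le_exp_of_nonneg (x := 32) (by norm_num) (G + 1)
      rw [sum_range_succ'] at h
      refine le_trans ?_ h
      simp
    calc E ≤ _ := sum_le_sum hinner
      _ ≤ 16 * r ^ G / ((G + 1 : ℕ) : ℝ) * exp 32 := by
          rw [← mul_sum]
          gcongr
      _ ≤ 16 * bR G / ((G + 1 : ℕ) : ℝ) * exp 32 := by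
          gcongr
          exact (bR_bounds G).1
      _ = _ := by ring
  have hmain : (Nat.factorial (2 * G) : ℝ) * bR G - 2 * d (G + 1) =
      2 * Nat.factorial (2 * G) * E := by
    have h : bR G = 2 * (d (G + 1) / Nat.factorial (2 * G) + E) := by
      rw [show d (G + 1) / Nat.factorial (2 * G) =
        (2 * ((G + 1 : ℕ) : ℝ) - 1) * d (G + 1) / Nat.factorial (2 * G + 1) by
          rw [Nat.factorial_succ]
          push_cast
          rw [show 2 * ((G : ℝ) + 1) - 1 = 2 * G + 1 by ring]
          field_simp]
      linarith
    rw [h]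
    field_simp
    ring
  rw [abs_sub_comm, hmain, abs_of_nonneg (by positivity)]
  calc _ ≤ 2 * Nat.factorial (2 * G) * (16 * exp 32 * bR G / ((G + 1 : ℕ) : ℝ)) := by gcongr
    _ = _ := by ring
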